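/- (Linear convergence of iterates while they remain in the ball; equation (A.star).) Let F : E → ℝ be differentiable and L-smooth with L > 0, let x̂ ∈ E be a global minimizer of F, and let σ > 0, δ > 0 be such that the local error bound holds: ‖x − x̂‖ ≤ σ·‖∇F(x)‖ for every x ∈ B(x̂, δ). Set μ = 1/(2Lσ²). Let x₀ ∈ E and let x_{j+1} = x_j − (1/L)·∇F(x_j) be the gradient-descent iterates. If x_j ∈ B(x̂, δ) for all 0 ≤ j ≤ k, then ‖x_k − x̂‖ ≤ (L/(√2·μ))·(1 − μ/L)^{k/2}·‖x₀ − x̂‖. -/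

import Mathlib

open Metric

theorem descent_aux {n : ℕ} (F : EuclideanSpace ℝ (Fin n) → ℝ)
    (hF : Differentiable ℝ F) (L : ℝ)
    (hsmooth : ∀ x₁ x₂, ‖gradient F x₁ - gradient F x₂‖ ≤ L * ‖x₁ - x₂‖)
    (x d : EuclideanSpace ℝ (Fin n)) :
    F (x + d) ≤ F x + inner ℝ (gradient F x) d + L / 2 * ‖d‖ ^ 2 := by
  have hd : ∀ t : ℝ, HasDerivAt
      (fun t : ℝ => F (x + t • d) - t * inner ℝ (gradient F x) d - L / 2 * ‖d‖ ^ 2 * t ^ 2)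
      (inner ℝ (gradient F (x + t • d)) d - inner ℝ (gradient F x) d
        - L / 2 * ‖d‖ ^ 2 * (2 * t)) t := by
    intro t
    have h1 : HasDerivAt (fun t : ℝ => x + t • d) d t := by
      simpa using ((hasDerivAt_id t).smul_const d).const_add x
    have h2 := (hF (x + t • d)).hasGradientAt.hasFDerivAt.comp_hasDerivAt t h1
    have h3 := (hasDerivAt_id t).mul_const (inner ℝ (gradient F x) d)
    have h4 := ((hasDerivAt_id t).pow 2).const_mul (L / 2 * ‖d‖ ^ 2)
    refine ((h2.sub h3).sub h4).congr_deriv ?_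
    simp
  have hanti := antitoneOn_of_deriv_nonpos (convex_Icc (0 : ℝ) 1)
    (fun t _ => (hd t).continuousAt.continuousWithinAt)
    (fun t _ => (hd t).differentiableAt.differentiableWithinAt)
    (fun t ht => by
      rw [interior_Icc] at ht
      rw [(hd t).deriv, ← inner_sub_left]
      have h5 := real_inner_le_norm (gradient F (x + t • d) - gradient F x) d
      have h6 := hsmooth (x + t • d) x
      rw [add_sub_cancel_left, norm_smul, Real.norm_of_nonneg ht.1.le] at h6
      have h7 := mul_le_mul_of_nonneg_right h6 (norm_nonneg d)
      nlinarith)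
  have := hanti (Set.left_mem_Icc.2 zero_le_one) (Set.right_mem_Icc.2 zero_le_one) zero_le_one
  simp only [zero_smul, one_smul, add_zero, zero_mul, one_mul, one_pow, mul_one, ne_eq, OfNat.ofNat_ne_zero, not_false_eq_true, zero_pow, mul_zero, sub_zero] at this
  linarith

/-- Equation (A.star): linear convergence of the gradient-descent iterates
while they remain in the ball where the local error bound holds, with
`μ = 1/(2Lσ²)`. -/
theorem linear_convergence_iterates
    (n : ℕ) (F : EuclideanSpace ℝ (Fin n) → ℝ)
    (hF : Differentiable ℝ F)
    (L : ℝ) (hL : 0 < L)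
    (hsmooth : ∀ x₁ x₂, ‖gradient F x₁ - gradient F x₂‖ ≤ L * ‖x₁ - x₂‖)
    (xhat : EuclideanSpace ℝ (Fin n))
    (hmin : ∀ x, F xhat ≤ F x)
    (σ δ : ℝ) (hσ : 0 < σ) (hδ : 0 < δ)
    (herr : ∀ x ∈ closedBall xhat δ, ‖x - xhat‖ ≤ σ * ‖gradient F x‖)
    (μ : ℝ) (hμ : μ = 1 / (2 * L * σ ^ 2))
    (x : ℕ → EuclideanSpace ℝ (Fin n))
    (hiter : ∀ j : ℕ, x (j + 1) = x j - (1 / L) • gradient F (x j))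
    (k : ℕ)
    (hball : ∀ j : ℕ, j ≤ k → x j ∈ closedBall xhat δ) :
    ‖x k - xhat‖ ≤
      L / (Real.sqrt 2 * μ) * (1 - μ / L) ^ ((k : ℝ) / 2) * ‖x 0 - xhat‖ := by
  have hdec : ∀ y, F (y - (1 / L) • gradient F y) ≤ F y - 1 / (2 * L) * ‖gradient F y‖ ^ 2 := by
    intro y
    have h := descent_aux F hF L hsmooth y (-((1 / L) • gradient F y))
    rw [inner_neg_right, inner_smul_right, real_inner_self_eq_norm_sq, norm_neg, norm_smul,
      Real.norm_of_nonneg (by positivity), ← sub_eq_add_neg] at h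
    refine h.trans (le_of_eq ?_)
    field_simp
    ring
  have hgn : ∀ y, ‖gradient F y‖ ^ 2 ≤ 2 * L * (F y - F xhat) := by
    intro y
    have h := (hmin _).trans (hdec y)
    have h2 : 1 / (2 * L) * ‖gradient F y‖ ^ 2 ≤ F y - F xhat := by linarith
    rw [one_div, inv_mul_le_iff₀ (by positivity)] at h2
    exact h2
  have hg0 : gradient F xhat = 0 := by
    have h := hgn xhat
    rw [sub_self, mul_zero] at h
    exact norm_eq_zero.1 (pow_eq_zero_iff two_ne_zero |>.1 (le_antisymm h (sq_nonneg _)))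
  have hup : ∀ y, F y - F xhat ≤ L / 2 * ‖y - xhat‖ ^ 2 := by
    intro y
    have h := descent_aux F hF L hsmooth xhat (y - xhat)
    rw [hg0, inner_zero_left, add_sub_cancel] at h
    linarith
  by_cases hx0 : x 0 = xhat
  · have hall : ∀ j, x j = xhat := by
      intro j
      induction j with
      | zero => exact hx0
      | succ j ih => rw [hiter, ih, hg0, smul_zero, sub_zero]
    simp [hall]
  have hpos : 0 < ‖x 0 - xhat‖ := norm_pos_iff.2 (sub_ne_zero.2 hx0)
  have hLσ : 1 ≤ L * σ := by
    have h1 := herr _ (hball 0 (Nat.zero_le _))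
    have h2 := hsmooth (x 0) xhat
    rw [hg0, sub_zero] at h2
    have h3 := h1.trans (mul_le_mul_of_nonneg_left h2 hσ.le)
    by_contra hc
    nlinarith
  have hr : 1 - μ / L = 1 - 1 / (2 * (L * σ) ^ 2) := by
    rw [hμ]; field_simp
  have hq : 1 / (2 * (L * σ) ^ 2) ≤ 1 := by
    rw [div_le_one (by positivity)]; nlinarith
  have hr0 : 0 ≤ 1 - μ / L := by rw [hr]; linarith
  have hstep : ∀ j, j ≤ k → F (x j) - F xhat ≤ (1 - μ / L) ^ j * (F (x 0) - F xhat) := by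
    intro j
    induction j with
    | zero => intro _; simp
    | succ j ih =>
      intro hj
      have ih := ih (by omega)
      have h1 := hdec (x j)
      rw [← hiter] at h1
      have h2 := herr _ (hball j (by omega))
      have h3 := hup (x j)
      have h4 : ‖x j - xhat‖ ^ 2 ≤ σ ^ 2 * ‖gradient F (x j)‖ ^ 2 := by
        rw [← mul_pow]; exact pow_le_pow_left₀ (norm_nonneg _) h2 2
      have h5 : 1 / (2 * (L * σ) ^ 2) * (F (x j) - F xhat)
          ≤ 1 / (2 * L) * ‖gradient F (x j)‖ ^ 2 := by
        calc _ ≤ 1 / (2 * (L * σ) ^ 2) * (L / 2 * (σ ^ 2 * ‖gradient F (x j)‖ ^ 2)) := by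
              gcongr
              exact h3.trans (by gcongr)
          _ = 1 / (4 * L) * ‖gradient F (x j)‖ ^ 2 := by field_simp; ring
          _ ≤ _ := by gcongr; linarith
      have h6 : F (x (j + 1)) - F xhat ≤ (1 - μ / L) * (F (x j) - F xhat) := by
        rw [hr]; linarith
      calc _ ≤ _ := h6
        _ ≤ (1 - μ / L) * ((1 - μ / L) ^ j * (F (x 0) - F xhat)) := by gcongr
        _ = _ := by ring
  have hμ0 : 0 < μ := by rw [hμ]; positivity
  refine le_of_abs_le (abs_le_of_sq_le_sq ?_ (by positivity))
  have hpow : ((1 - μ / L) ^ ((k : ℝ) / 2)) ^ 2 = (1 - μ / L) ^ k := by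
    rw [← Real.rpow_natCast, ← Real.rpow_mul hr0, ← Real.rpow_natCast]
    congr 1
    push_cast; ring
  rw [mul_pow, mul_pow, hpow, div_pow, mul_pow, Real.sq_sqrt (by norm_num)]
  calc ‖x k - xhat‖ ^ 2 ≤ (σ * ‖gradient F (x k)‖) ^ 2 :=
        pow_le_pow_left₀ (norm_nonneg _) (herr _ (hball k le_rfl)) 2
    _ = σ ^ 2 * ‖gradient F (x k)‖ ^ 2 := by ring
    _ ≤ σ ^ 2 * (2 * L * ((1 - μ / L) ^ k * (L / 2 * ‖x 0 - xhat‖ ^ 2))) := by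
        gcongr
        refine (hgn _).trans ?_
        gcongr
        refine (hstep k le_rfl).trans ?_
        gcongr
        exact hup _
    _ = (L * σ) ^ 2 * ((1 - μ / L) ^ k * ‖x 0 - xhat‖ ^ 2) := by ring
    _ ≤ L ^ 2 / (2 * μ ^ 2) * ((1 - μ / L) ^ k * ‖x 0 - xhat‖ ^ 2) := by
        gcongr
        have : L ^ 2 / (2 * μ ^ 2) = 2 * (L * σ) ^ 4 := by
          rw [hμ]; field_simp
        rw [this]
        have h1 : 1 ≤ (L * σ) ^ 2 := by nlinarith
        nlinarith
    _ = _ := by ring
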